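/- Let X be a real Banach space admitting a C¹ Lipschitz bump function, let H : [0,∞) × X × ℝ → ℝ be a continuous Hamiltonian satisfying the evolution condition (A), and let h : X → ℝ be bounded and L-Lipschitz. Suppose K₀, K₁ ∈ ℝ satisfy K₀ ≤ H(t,x,m) ≤ K₁ for all t > 0, x ∈ X and |m| ≤ L. Let 𝓕 be the family of viscosity subsolutions w : [0,∞) × X → ℝ of w_t + H(t, x, ‖w_x‖) = 0 with initial condition h such that −K₁·t + h(x) ≤ w(t,x) ≤ −K₀·t + h(x) for all (t,x) ∈ (0,∞) × X, and let u = sup 𝓕. Then the upper semicontinuous envelope u* is a viscosity subsolution with initial condition h, and its lower semicontinuous envelope (u*)_* is a viscosity supersolution with initial condition h. -/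

import Mathlib

open Filter Topology

variable {X : Type*} [NormedAddCommGroup X] [NormedSpace ℝ X]

/-- `X` admits a `C¹` Lipschitz bump function. -/
def HasC1LipBump (X : Type*) [NormedAddCommGroup X] [NormedSpace ℝ X] : Prop :=
  ∃ b : X → ℝ, ContDiff ℝ 1 b ∧ (∃ K : NNReal, LipschitzWith K b) ∧
    Bornology.IsBounded (Function.support b) ∧ (Function.support b).Nonempty

/-- The parabolic superdifferential of `u : [0,∞) × X → ℝ` at `(t,x)`. -/
def psuperdiff (u : ℝ → X → ℝ) (t : ℝ) (x : X) : Set (ℝ × (X →L[ℝ] ℝ)) :=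
  {p | ∀ ε > (0:ℝ), ∃ δ > (0:ℝ), ∀ (s : ℝ) (k : X), |s| + ‖k‖ < δ → 0 ≤ t + s →
    u (t + s) (x + k) ≤ u t x + p.1 * s + p.2 k + ε * (|s| + ‖k‖)}

/-- The parabolic subdifferential of `u : [0,∞) × X → ℝ` at `(t,x)`. -/
def psubdiff (u : ℝ → X → ℝ) (t : ℝ) (x : X) : Set (ℝ × (X →L[ℝ] ℝ)) :=
  {p | ∀ ε > (0:ℝ), ∃ δ > (0:ℝ), ∀ (s : ℝ) (k : X), |s| + ‖k‖ < δ → 0 ≤ t + s →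
    u t x + p.1 * s + p.2 k - ε * (|s| + ‖k‖) ≤ u (t + s) (x + k)}

/-- The evolution condition (A) for a Hamiltonian `H : [0,∞) × X × ℝ → ℝ`. -/
def CondAEvol (H : ℝ → X → ℝ → ℝ) : Prop :=
  ∃ (C : ℝ) (ω : ℝ → ℝ → ℝ → ℝ), 0 ≤ C ∧
    ContinuousOn (fun p : ℝ × ℝ × ℝ => ω p.1 p.2.1 p.2.2) {p : ℝ × ℝ × ℝ | 0 ≤ p.1} ∧
    ω 0 0 0 = 0 ∧
    ∀ (t₁ t₂ : ℝ), 0 ≤ t₁ → 0 ≤ t₂ → ∀ (x₁ x₂ : X) (r₁ r₂ : ℝ),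
      |H t₁ x₁ r₁ - H t₂ x₂ r₂| ≤
        ω |t₁ - t₂| ‖x₁ - x₂‖ (r₁ - r₂) + C * max |r₁| |r₂| * (|t₁ - t₂| + ‖x₁ - x₂‖)

/-- `u` is a viscosity subsolution of `u_t + H(t, x, ‖u_x‖) = 0` with
initial condition `u(0,·) ≤ h`. -/
def IsEvolSub (H : ℝ → X → ℝ → ℝ) (h : X → ℝ) (u : ℝ → X → ℝ) : Prop :=
  UpperSemicontinuousOn (fun p : ℝ × X => u p.1 p.2) {p : ℝ × X | 0 ≤ p.1} ∧
  (∀ t : ℝ, 0 < t → ∀ x : X, ∀ p ∈ psuperdiff u t x, p.1 + H t x ‖p.2‖ ≤ 0) ∧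
  (∀ x : X, u 0 x ≤ h x)

/-- `v` is a viscosity supersolution of `v_t + H(t, x, ‖v_x‖) = 0` with
initial condition `v(0,·) ≥ h`. -/
def IsEvolSuper (H : ℝ → X → ℝ → ℝ) (h : X → ℝ) (v : ℝ → X → ℝ) : Prop :=
  LowerSemicontinuousOn (fun p : ℝ × X => v p.1 p.2) {p : ℝ × X | 0 ≤ p.1} ∧
  (∀ t : ℝ, 0 < t → ∀ x : X, ∀ p ∈ psubdiff v t x, 0 ≤ p.1 + H t x ‖p.2‖) ∧
  (∀ x : X, h x ≤ v 0 x)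

/-- The upper semicontinuous envelope of `u : [0,∞) × X → ℝ`. -/
noncomputable def uscEnvP (u : ℝ → X → ℝ) : ℝ → X → ℝ := fun t x =>
  Filter.limsup (fun p : ℝ × X => u p.1 p.2) (𝓝[{p : ℝ × X | 0 ≤ p.1}] (t, x))

/-- The lower semicontinuous envelope of `u : [0,∞) × X → ℝ`. -/
noncomputable def lscEnvP (u : ℝ → X → ℝ) : ℝ → X → ℝ := fun t x =>
  Filter.liminf (fun p : ℝ × X => u p.1 p.2) (𝓝[{p : ℝ × X | 0 ≤ p.1}] (t, x))

section SmoothVariationalPrinciple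

/-- A normalised bump function at the origin: differentiable, Lipschitz with constant `K`, with
values in `[0, M]`, equal to `1` at `0` and vanishing outside the open unit ball. -/
structure IsUnitBump {E : Type*} [NormedAddCommGroup E] [NormedSpace ℝ E]
    (B : E → ℝ) (M K : ℝ) : Prop where
  differentiable : Differentiable ℝ B
  nonneg : ∀ z, 0 ≤ B z
  le : ∀ z, B z ≤ M
  map_zero : B 0 = 1
  eq_zero : ∀ z, 1 ≤ ‖z‖ → B z = 0
  lip_nonneg : 0 ≤ K
  lip : ∀ z z', |B z - B z'| ≤ K * ‖z - z'‖

variable {E : Type*} [NormedAddCommGroup E] [NormedSpace ℝ E]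

lemma IsUnitBump.one_le {B : E → ℝ} {M K : ℝ} (hB : IsUnitBump B M K) : 1 ≤ M :=
  hB.map_zero ▸ hB.le 0

lemma IsUnitBump.hasFDerivAt_comp {B : E → ℝ} {M K : ℝ} (hB : IsUnitBump B M K)
    (c r : ℝ) (hc : 0 ≤ c) (hr : 0 ≤ r) (a z : E) :
    HasFDerivAt (fun z => c * B (r • (z - a)))
      (fderiv ℝ (fun z => c * B (r • (z - a))) z) z ∧
    ‖fderiv ℝ (fun z => c * B (r • (z - a))) z‖ ≤ c * K * r := by
  constructor
  · have hd : DifferentiableAt ℝ (fun z => B (r • (z - a))) z :=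
      (hB.differentiable _).comp (f := fun z => r • (z - a)) z (by fun_prop)
    exact (hd.const_mul c).hasFDerivAt
  · have := hB.lip_nonneg
    refine norm_fderiv_le_of_lip' ℝ (by positivity) (Eventually.of_forall fun y => ?_)
    rw [← mul_sub, norm_mul, Real.norm_of_nonneg hc, Real.norm_eq_abs]
    have h1 := hB.lip (r • (y - a)) (r • (z - a))
    rw [← smul_sub, norm_smul, Real.norm_of_nonneg hr, sub_sub_sub_cancel_right] at h1
    calc c * |B (r • (y - a)) - B (r • (z - a))| ≤ c * (K * (r * ‖y - z‖)) := by gcongr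
      _ = c * K * r * ‖y - z‖ := by ring

/-- A smooth variational principle: a bounded above upper semicontinuous function on a closed set
attains its maximum after a small differentiable perturbation. -/
theorem exists_perturbed_max [CompleteSpace E] {B : E → ℝ} {M K : ℝ} (hB : IsUnitBump B M K)
    {f : E → ℝ} {S : Set E} (hS : IsClosed S) (hne : S.Nonempty)
    (hf : UpperSemicontinuousOn f S) {A : ℝ} (hA : ∀ y ∈ S, f y ≤ A) {η : ℝ} (hη : 0 < η) :
    ∃ (g : E → ℝ) (g' : E → E →L[ℝ] ℝ), (∀ z, HasFDerivAt g (g' z) z) ∧ (∀ z, ‖g' z‖ ≤ η) ∧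
      (∀ z, 0 ≤ g z) ∧ (∀ z, g z ≤ η) ∧
      ∃ z ∈ S, ∀ y ∈ S, f y + g y ≤ f z + g z := by
  have hM := hB.one_le
  have hK := hB.lip_nonneg
  set a : ℝ := η / (4 * (M + K)) with ha
  have ha0 : 0 < a := by positivity
  have haM : 2 * a * M * 2 ≤ η := by
    rw [ha]; field_simp; nlinarith
  have haK : 2 * a * K * 2 ≤ η := by
    rw [ha]; field_simp; nlinarith
  set ε : ℕ → ℝ := fun n => a * (1 / 4) ^ n with hε
  have hε0 : ∀ n, 0 < ε n := fun n => by positivity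
  have sel : ∀ (G : E → ℝ) (n : ℕ), ∃ x, (∃ C, ∀ y, G y ≤ C) →
      x ∈ S ∧ ∀ y ∈ S, f y + G y ≤ f x + G x + ε n := by
    intro G n
    by_cases hG : ∃ C, ∀ y, G y ≤ C
    · obtain ⟨C, hC⟩ := hG
      have hbdd : BddAbove ((fun y => f y + G y) '' S) := by
        refine ⟨A + C, ?_⟩
        rintro _ ⟨y, hy, rfl⟩
        exact add_le_add (hA y hy) (hC y)
      obtain ⟨_, ⟨x, hx, rfl⟩, hlt⟩ := exists_lt_of_lt_csSup (hne.image (fun y => f y + G y))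
        (sub_lt_self (sSup ((fun y => f y + G y) '' S)) (hε0 n))
      refine ⟨x, fun _ => ⟨hx, fun y hy => ?_⟩⟩
      have := le_csSup hbdd ⟨y, hy, rfl⟩
      simp only at this hlt
      linarith
    · exact ⟨0, fun h => absurd h hG⟩
  choose pick hpick using sel
  let G : ℕ → E → ℝ := fun n => Nat.rec (fun _ => 0)
    (fun n G z => G z + 2 * ε n * B ((2 : ℝ) ^ n • (z - pick G n))) n
  let x : ℕ → E := fun n => pick (G n) n
  let T : ℕ → E → ℝ := fun n z => 2 * ε n * B ((2 : ℝ) ^ n • (z - x n))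
  have hGs : ∀ n z, G (n + 1) z = G n z + T n z := fun n z => rfl
  have hG : ∀ n z, G n z = ∑ i ∈ Finset.range n, T i z := by
    intro n z
    induction n with
    | zero => rfl
    | succ n ih => rw [hGs, ih, Finset.sum_range_succ]
  have hT0 : ∀ n z, 0 ≤ T n z := fun n z => by
    have := hB.nonneg ((2 : ℝ) ^ n • (z - x n))
    have := hε0 n
    positivity
  have hTb : ∀ n z, T n z ≤ 2 * ε n * M := fun n z => by
    have := hε0 n
    exact mul_le_mul_of_nonneg_left (hB.le _) (by positivity)
  have hGb : ∀ n, ∃ C, ∀ y, G n y ≤ C := fun n =>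
    ⟨_, fun y => (hG n y).trans_le (Finset.sum_le_sum fun i _ => hTb i y)⟩
  have hxS : ∀ n, x n ∈ S := fun n => (hpick (G n) n (hGb n)).1
  have hxm : ∀ n, ∀ y ∈ S, f y + G n y ≤ f (x n) + G n (x n) + ε n :=
    fun n => (hpick (G n) n (hGb n)).2
  have hdist : ∀ n, dist (x n) (x (n + 1)) ≤ 1 * (1 / 2 : ℝ) ^ n := by
    intro n
    by_contra! hcon
    have h1 : T n (x (n + 1)) = 0 := by
      have : B ((2 : ℝ) ^ n • (x (n + 1) - x n)) = 0 := by
        apply hB.eq_zero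
        rw [dist_comm, dist_eq_norm, one_mul] at hcon
        rw [norm_smul, norm_pow, Real.norm_ofNat]
        calc (1 : ℝ) = 2 ^ n * (1 / 2) ^ n := by rw [← mul_pow]; norm_num
          _ ≤ _ := by gcongr
      simp only [T, this, mul_zero]
    have h2 : T n (x n) = 2 * ε n := by simp [T, hB.map_zero]
    have h3 := hxm n _ (hxS (n + 1))
    have h4 := hxm (n + 1) _ (hxS n)
    rw [hGs, hGs, h1, h2] at h4
    have h5 : ε (n + 1) < ε n := by
      have := hε0 n
      have : ε (n + 1) = ε n * (1 / 4) := by simp only [hε]; ring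
      linarith
    linarith
  obtain ⟨z, hz⟩ := cauchySeq_tendsto_of_complete
    (cauchySeq_of_le_geometric (1 / 2) 1 (by norm_num) hdist)
  have hzS : z ∈ S := hS.mem_of_tendsto hz (Eventually.of_forall hxS)
  have hgeo : ∀ c : ℝ, HasSum (fun n : ℕ => 2 * a * c * (1 / 2 : ℝ) ^ n) (2 * a * c * 2) :=
    fun c => hasSum_geometric_two.mul_left _
  have hTM : ∀ n z, ‖T n z‖ ≤ 2 * a * M * (1 / 2) ^ n := by
    intro n z
    rw [Real.norm_of_nonneg (hT0 n z)]
    refine (hTb n z).trans ?_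
    have : ((1 : ℝ) / 4) ^ n ≤ (1 / 2) ^ n := by gcongr; norm_num
    calc 2 * ε n * M = 2 * a * M * (1 / 4) ^ n := by simp only [hε]; ring
      _ ≤ _ := by gcongr
  have hTs : ∀ z, Summable fun n => T n z := fun z =>
    Summable.of_norm_bounded (hgeo M).summable fun n => hTM n z
  have hT' : ∀ n z, ‖fderiv ℝ (T n) z‖ ≤ 2 * a * K * (1 / 2) ^ n := by
    intro n z
    have := hε0 n
    refine (hB.hasFDerivAt_comp (2 * ε n) (2 ^ n) (by positivity) (by positivity) (x n) z).2.trans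
      (le_of_eq ?_)
    have : ((1 : ℝ) / 4) ^ n * 2 ^ n = (1 / 2) ^ n := by rw [← mul_pow]; norm_num
    simp only [hε]
    rw [← this]; ring
  have hgd : ∀ z, HasFDerivAt (fun y => ∑' n, T n y) (∑' n, fderiv ℝ (T n) z) z := fun z => by
    refine hasFDerivAt_tsum (hgeo K).summable (fun n y => ?_) hT' (hTs z) z
    have := hε0 n
    exact (hB.hasFDerivAt_comp (2 * ε n) (2 ^ n) (by positivity) (by positivity) (x n) y).1
  refine ⟨fun y => ∑' n, T n y, _, hgd, fun z => ?_, fun z => tsum_nonneg fun n => hT0 n z,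
    fun z => ?_, z, hzS, fun y hy => ?_⟩
  · exact (tsum_of_norm_bounded (hgeo K) fun n => hT' n z).trans haK
  · exact ((Real.le_norm_self _).trans (tsum_of_norm_bounded (hgeo M) fun n => hTM n z)).trans haM
  · refine le_of_forall_pos_le_add fun δ hδ => ?_
    have hlim : Tendsto (fun n => f y + G n y) atTop (𝓝 (f y + ∑' n, T n y)) := by
      simp_rw [hG]
      exact (hTs y).hasSum.tendsto_sum_nat.const_add _
    refine le_of_tendsto hlim ?_
    have h1 : ∀ᶠ n in atTop, f (x n) < f z + δ / 3 :=
      (tendsto_nhdsWithin_iff.2 ⟨hz, Eventually.of_forall hxS⟩).eventually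
        (hf z hzS (f z + δ / 3) (by linarith))
    have h2 : ∀ᶠ n in atTop, ∑' i, T i (x n) < (∑' i, T i z) + δ / 3 :=
      ((hgd z).continuousAt.tendsto.comp hz).eventually (gt_mem_nhds (by linarith))
    have h3 : ∀ᶠ n in atTop, ε n < δ / 3 := by
      have : Tendsto ε atTop (𝓝 (a * 0)) :=
        (tendsto_pow_atTop_nhds_zero_of_lt_one (by norm_num) (by norm_num)).const_mul a
      exact this.eventually (gt_mem_nhds (by simpa using (by positivity : 0 < δ / 3)))
    filter_upwards [h1, h2, h3] with n h1 h2 h3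
    have h4 := hxm n y hy
    have h5 : G n (x n) ≤ ∑' i, T i (x n) := by
      rw [hG]
      exact (hTs _).sum_le_tsum _ fun i _ => hT0 i _
    linarith

end SmoothVariationalPrinciple

section ProductBump

lemma lip_mul_of_bounded {E : Type*} [NormedAddCommGroup E] {f g : E → ℝ} {A B K K' : ℝ}
    (hf : ∀ x, |f x| ≤ A) (hg : ∀ x, |g x| ≤ B)
    (hfK : ∀ x y, |f x - f y| ≤ K * ‖x - y‖) (hgK : ∀ x y, |g x - g y| ≤ K' * ‖x - y‖)
    (x y : E) : |f x * g x - f y * g y| ≤ (A * K' + K * B) * ‖x - y‖ := by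
  have hA : 0 ≤ A := (abs_nonneg _).trans (hf x)
  calc |f x * g x - f y * g y| = |f x * (g x - g y) + (f x - f y) * g y| := by ring_nf
    _ ≤ |f x| * |g x - g y| + |f x - f y| * |g y| := by
        rw [← abs_mul, ← abs_mul]; exact abs_add_le _ _
    _ ≤ A * (K' * ‖x - y‖) + (K * ‖x - y‖) * B := by
        gcongr
        · exact hf x
        · exact hgK x y
        · exact (abs_nonneg _).trans (hfK x y)
        · exact hfK x y
        · exact hg y
    _ = _ := by ring

/-- A space with a `C¹` Lipschitz bump carries a normalised bump. -/
lemma HasC1LipBump.exists_isUnitBump {X : Type*} [NormedAddCommGroup X] [NormedSpace ℝ X]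
    (hb : HasC1LipBump X) : ∃ (B : X → ℝ) (M K : ℝ), IsUnitBump B M K := by
  obtain ⟨b, hbC, ⟨K, hK⟩, hbd, x₀, hx₀⟩ := hb
  obtain ⟨R, hR⟩ := hbd.subset_closedBall 0
  have hx₀' : b x₀ ≠ 0 := hx₀
  have hR0 : 0 ≤ R := (norm_nonneg x₀).trans (by simpa using hR hx₀)
  have hzero : ∀ y, R < ‖y‖ → b y = 0 := fun y hy => by
    by_contra hne
    have : ‖y‖ ≤ R := by simpa using hR (show y ∈ Function.support b from hne)
    linarith
  have hlip : ∀ x y, |b x - b y| ≤ K * ‖x - y‖ := fun x y => by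
    simpa [Real.norm_eq_abs] using hK.norm_sub_le x y
  obtain ⟨A, hA⟩ : ∃ A, ∀ y, |b y| ≤ A := by
    refine ⟨|b x₀| + K * (R + ‖x₀‖), fun y => ?_⟩
    rcases lt_or_ge R ‖y‖ with hy | hy
    · rw [hzero y hy, abs_zero]; positivity
    · calc |b y| = |b x₀ + (b y - b x₀)| := by ring_nf
        _ ≤ |b x₀| + |b y - b x₀| := abs_add_le _ _
        _ ≤ |b x₀| + K * ‖y - x₀‖ := by gcongr; exact hlip _ _
        _ ≤ _ := by gcongr; exact (norm_sub_le _ _).trans (by gcongr)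
  set ρ : ℝ := R + ‖x₀‖ + 1
  have hρ : 0 < ρ := by positivity
  set c : X → ℝ := fun x => b (x₀ + ρ • x) / b x₀ with hc
  have hcA : ∀ x, |c x| ≤ A / |b x₀| := fun x => by
    rw [hc, abs_div]; gcongr; exact hA _
  have hcl : ∀ x y, |c x - c y| ≤ (K * ρ / |b x₀|) * ‖x - y‖ := fun x y => by
    simp only [hc]
    rw [← sub_div, abs_div]
    have := hlip (x₀ + ρ • x) (x₀ + ρ • y)
    rw [add_sub_add_left_eq_sub, ← smul_sub, norm_smul, Real.norm_of_nonneg hρ.le] at this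
    calc _ ≤ K * (ρ * ‖x - y‖) / |b x₀| := by gcongr
      _ = _ := by ring
  have hA0 : 0 ≤ A := (abs_nonneg _).trans (hA 0)
  have hbdiff : Differentiable ℝ b := hbC.differentiable one_ne_zero
  have hcd : Differentiable ℝ c := by fun_prop
  refine ⟨fun x => c x * c x, (A / |b x₀|) * (A / |b x₀|), _, hcd.mul hcd,
    fun z => mul_self_nonneg _, fun z => ?_, ?_, fun z hz => ?_, ?_,
    lip_mul_of_bounded hcA hcA hcl hcl⟩
  · rw [← abs_mul_abs_self]
    exact mul_self_le_mul_self (abs_nonneg _) (hcA z)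
  · simp [hc, hx₀']
  · have : b (x₀ + ρ • z) = 0 := by
      apply hzero
      have h1 : ‖ρ • z‖ ≤ ‖x₀ + ρ • z‖ + ‖x₀‖ := by
        simpa using norm_sub_le (x₀ + ρ • z) x₀
      rw [norm_smul, Real.norm_of_nonneg hρ.le] at h1
      have h2 : ρ * 1 ≤ ρ * ‖z‖ := by gcongr
      simp only [ρ] at h1 h2
      linarith
    simp [hc, this]
  · positivity

lemma exists_isUnitBump_real : ∃ (B : ℝ → ℝ) (M K : ℝ), IsUnitBump B M K := by
  let β : ContDiffBump (0 : ℝ) := ⟨1 / 2, 1, by norm_num, by norm_num⟩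
  have hβ : ContDiff ℝ 1 β := β.contDiff
  refine HasC1LipBump.exists_isUnitBump ⟨β, hβ,
    hβ.lipschitzWith_of_hasCompactSupport β.hasCompactSupport one_ne_zero, ?_, 0, ?_⟩
  · rw [β.support_eq]; exact Metric.isBounded_ball
  · rw [β.support_eq]; exact Metric.mem_ball_self β.rOut_pos

lemma IsUnitBump.prod {X Y : Type*} [NormedAddCommGroup X] [NormedSpace ℝ X]
    [NormedAddCommGroup Y] [NormedSpace ℝ Y] {B : X → ℝ} {B' : Y → ℝ} {M K M' K' : ℝ}
    (hB : IsUnitBump B M K) (hB' : IsUnitBump B' M' K') :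
    IsUnitBump (fun z : X × Y => B z.1 * B' z.2) (M * M') (M * K' + K * M') := by
  have hM := hB.one_le
  have hM' := hB'.one_le
  have hK := hB.lip_nonneg
  have hK' := hB'.lip_nonneg
  refine ⟨?_, fun z => mul_nonneg (hB.nonneg _) (hB'.nonneg _), fun z => ?_, ?_, fun z hz => ?_,
    by positivity, lip_mul_of_bounded (f := fun z : X × Y => B z.1) (g := fun z : X × Y => B' z.2)
      (fun z => ?_) (fun z => ?_) (fun z z' => ?_) (fun z z' => ?_)⟩
  · exact (hB.differentiable.comp differentiable_fst).mul
      (hB'.differentiable.comp differentiable_snd)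
  · exact mul_le_mul (hB.le _) (hB'.le _) (hB'.nonneg _) (by positivity)
  · simp [hB.map_zero, hB'.map_zero]
  · rw [Prod.norm_def, le_max_iff] at hz
    rcases hz with hz | hz
    · simp [hB.eq_zero _ hz]
    · simp [hB'.eq_zero _ hz]
  · rw [abs_of_nonneg (hB.nonneg _)]; exact hB.le _
  · rw [abs_of_nonneg (hB'.nonneg _)]; exact hB'.le _
  · exact (hB.lip _ _).trans (by gcongr; exact norm_fst_le (z - z'))
  · exact (hB'.lip _ _).trans (by gcongr; exact norm_snd_le (z - z'))

end ProductBump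

section Envelopes

variable {E : Type*} [TopologicalSpace E] {S : Set E} {f g₀ g₁ : E → ℝ} {p : E}

lemma isBoundedUnder_le_nhdsWithin (hg : ContinuousOn g₁ S) (hfg : ∀ q ∈ S, f q ≤ g₁ q)
    (hp : p ∈ S) : (𝓝[S] p).IsBoundedUnder (· ≤ ·) f := by
  refine ⟨g₁ p + 1, ?_⟩
  rw [eventually_map]
  filter_upwards [(hg p hp).eventually (gt_mem_nhds (lt_add_one (g₁ p))), self_mem_nhdsWithin]
    with q hq hqS using (hfg q hqS).trans hq.le

lemma isBoundedUnder_ge_nhdsWithin (hg : ContinuousOn g₀ S) (hfg : ∀ q ∈ S, g₀ q ≤ f q)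
    (hp : p ∈ S) : (𝓝[S] p).IsBoundedUnder (· ≥ ·) f := by
  refine ⟨g₀ p - 1, ?_⟩
  rw [eventually_map]
  filter_upwards [(hg p hp).eventually (lt_mem_nhds (sub_one_lt (g₀ p))), self_mem_nhdsWithin]
    with q hq hqS using hq.le.trans (hfg q hqS)

lemma nhdsWithin_neBot_of_mem' (hp : p ∈ S) : (𝓝[S] p).NeBot :=
  mem_closure_iff_nhdsWithin_neBot.1 (subset_closure hp)

lemma limsup_nhdsWithin_le (hg₀ : ContinuousOn g₀ S) (h₀ : ∀ q ∈ S, g₀ q ≤ f q)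
    (hg : ContinuousOn g₁ S) (hfg : ∀ q ∈ S, f q ≤ g₁ q) (hp : p ∈ S) :
    limsup f (𝓝[S] p) ≤ g₁ p := by
  have := nhdsWithin_neBot_of_mem' hp
  refine le_of_forall_gt_imp_ge_of_dense fun c hc => ?_
  refine limsup_le_of_le (isBoundedUnder_ge_nhdsWithin hg₀ h₀ hp).isCoboundedUnder_le ?_
  filter_upwards [(hg p hp).eventually (gt_mem_nhds hc), self_mem_nhdsWithin]
    with q hq hqS using (hfg q hqS).trans hq.le

lemma le_liminf_nhdsWithin (hg₁ : ContinuousOn g₁ S) (h₁ : ∀ q ∈ S, f q ≤ g₁ q)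
    (hg : ContinuousOn g₀ S) (hfg : ∀ q ∈ S, g₀ q ≤ f q) (hp : p ∈ S) :
    g₀ p ≤ liminf f (𝓝[S] p) := by
  have := nhdsWithin_neBot_of_mem' hp
  refine le_of_forall_lt_imp_le_of_dense fun c hc => ?_
  refine le_liminf_of_le (isBoundedUnder_le_nhdsWithin hg₁ h₁ hp).isCoboundedUnder_ge ?_
  filter_upwards [(hg p hp).eventually (lt_mem_nhds hc), self_mem_nhdsWithin]
    with q hq hqS using hq.le.trans (hfg q hqS)

lemma le_limsup_nhdsWithin (hg : ContinuousOn g₁ S) (hfg : ∀ q ∈ S, f q ≤ g₁ q) (hp : p ∈ S) :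
    f p ≤ limsup f (𝓝[S] p) := by
  refine le_of_forall_gt_imp_ge_of_dense fun c hc => ?_
  exact ((eventually_lt_of_limsup_lt hc
    (isBoundedUnder_le_nhdsWithin hg hfg hp)).self_of_nhdsWithin hp).le

lemma liminf_nhdsWithin_le (hg : ContinuousOn g₀ S) (hfg : ∀ q ∈ S, g₀ q ≤ f q) (hp : p ∈ S) :
    liminf f (𝓝[S] p) ≤ f p := by
  refine le_of_forall_lt_imp_le_of_dense fun c hc => ?_
  exact ((eventually_lt_of_lt_liminf hc
    (isBoundedUnder_ge_nhdsWithin hg hfg hp)).self_of_nhdsWithin hp).le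

lemma upperSemicontinuousOn_limsup_nhdsWithin (hg₀ : ContinuousOn g₀ S)
    (h₀ : ∀ q ∈ S, g₀ q ≤ f q) (hg₁ : ContinuousOn g₁ S) (h₁ : ∀ q ∈ S, f q ≤ g₁ q) :
    UpperSemicontinuousOn (fun p => limsup f (𝓝[S] p)) S := by
  intro p hp c hc
  obtain ⟨d, hd, hdc⟩ := exists_between hc
  have := eventually_lt_of_limsup_lt hd (isBoundedUnder_le_nhdsWithin hg₁ h₁ hp)
  filter_upwards [eventually_eventually_nhdsWithin.2 this, self_mem_nhdsWithin] with q hq hqS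
  have := nhdsWithin_neBot_of_mem' hqS
  exact (limsup_le_of_le (isBoundedUnder_ge_nhdsWithin hg₀ h₀ hqS).isCoboundedUnder_le
    (hq.mono fun _ h => h.le)).trans_lt hdc

lemma lowerSemicontinuousOn_liminf_nhdsWithin (hg₀ : ContinuousOn g₀ S)
    (h₀ : ∀ q ∈ S, g₀ q ≤ f q) (hg₁ : ContinuousOn g₁ S) (h₁ : ∀ q ∈ S, f q ≤ g₁ q) :
    LowerSemicontinuousOn (fun p => liminf f (𝓝[S] p)) S := by
  intro p hp c hc
  obtain ⟨d, hcd, hd⟩ := exists_between hc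
  have := eventually_lt_of_lt_liminf hd (isBoundedUnder_ge_nhdsWithin hg₀ h₀ hp)
  filter_upwards [eventually_eventually_nhdsWithin.2 this, self_mem_nhdsWithin] with q hq hqS
  have := nhdsWithin_neBot_of_mem' hqS
  exact hcd.trans_le (le_liminf_of_le
    (isBoundedUnder_le_nhdsWithin hg₁ h₁ hqS).isCoboundedUnder_ge (hq.mono fun _ h => h.le))

end Envelopes

section Differentials

/-- The functional `(s, k) ↦ α s + Δ k` on `ℝ × X`. -/
noncomputable def pairFunctional (p : ℝ × (X →L[ℝ] ℝ)) : ℝ × X →L[ℝ] ℝ :=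
  p.1 • ContinuousLinearMap.fst ℝ ℝ X + p.2.comp (ContinuousLinearMap.snd ℝ ℝ X)

@[simp] lemma pairFunctional_apply (p : ℝ × (X →L[ℝ] ℝ)) (z : ℝ × X) :
    pairFunctional p z = p.1 * z.1 + p.2 z.2 := rfl

/-- The components `(ℓ (1, 0), ℓ (0, ·))` of a functional on `ℝ × X`. -/
noncomputable def functionalPair (ℓ : ℝ × X →L[ℝ] ℝ) : ℝ × (X →L[ℝ] ℝ) :=
  (ℓ (1, 0), ℓ.comp (ContinuousLinearMap.inr ℝ ℝ X))

lemma pairFunctional_functionalPair (ℓ : ℝ × X →L[ℝ] ℝ) :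
    pairFunctional (functionalPair ℓ) = ℓ := by
  refine ContinuousLinearMap.ext fun z => ?_
  have h1 : z = z.1 • ((1, 0) : ℝ × X) + (0, z.2) := by ext <;> simp
  conv_rhs => rw [h1, map_add, map_smul]
  simp [functionalPair, mul_comm]

lemma functionalPair_pairFunctional (p : ℝ × (X →L[ℝ] ℝ)) :
    functionalPair (pairFunctional p) = p := by
  ext <;> simp [functionalPair]

lemma abs_functionalPair_fst_sub_le (p : ℝ × (X →L[ℝ] ℝ)) (e : ℝ × X →L[ℝ] ℝ) :
    |(functionalPair (pairFunctional p + e)).1 - p.1| ≤ ‖e‖ := by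
  have := e.le_opNorm (1, 0)
  simpa [functionalPair, Prod.norm_def] using this

lemma abs_norm_functionalPair_snd_sub_le (p : ℝ × (X →L[ℝ] ℝ)) (e : ℝ × X →L[ℝ] ℝ) :
    |‖(functionalPair (pairFunctional p + e)).2‖ - ‖p.2‖| ≤ ‖e‖ := by
  refine (abs_norm_sub_norm_le _ _).trans (ContinuousLinearMap.opNorm_le_bound _ (norm_nonneg _)
    fun k => ?_)
  have := e.le_opNorm (0, k)
  simpa [functionalPair, Prod.norm_def] using this

lemma norm_le_abs_add_norm {Y : Type*} [NormedAddCommGroup Y] (z : ℝ × Y) : ‖z‖ ≤ |z.1| + ‖z.2‖ :=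
  max_le (le_add_of_nonneg_right (norm_nonneg _)) (le_add_of_nonneg_left (abs_nonneg _))

lemma abs_add_norm_le {Y : Type*} [NormedAddCommGroup Y] (z : ℝ × Y) : |z.1| + ‖z.2‖ ≤ 2 * ‖z‖ := by
  have h1 : |z.1| ≤ ‖z‖ := norm_fst_le z
  have h2 := norm_snd_le z
  linarith

lemma psuperdiff_iff {u : ℝ → X → ℝ} {p : ℝ × X} {d : ℝ × (X →L[ℝ] ℝ)} :
    d ∈ psuperdiff u p.1 p.2 ↔ ∀ ε > (0 : ℝ), ∀ᶠ q in 𝓝[{q : ℝ × X | 0 ≤ q.1}] p,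
      u q.1 q.2 ≤ u p.1 p.2 + pairFunctional d (q - p) + ε * ‖q - p‖ := by
  constructor
  · intro h ε hε
    obtain ⟨δ, hδ, h⟩ := h (ε / 2) (by positivity)
    filter_upwards [nhdsWithin_le_nhds (Metric.ball_mem_nhds p (half_pos hδ)),
      self_mem_nhdsWithin] with q hq hqS
    rw [Metric.mem_ball, dist_eq_norm] at hq
    have h1 := abs_add_norm_le (q - p)
    have h2 := h (q - p).1 (q - p).2 (by linarith) (by simpa using hqS)
    simp only [Prod.fst_sub, Prod.snd_sub, add_sub_cancel] at h2
    simp only [Prod.fst_sub, Prod.snd_sub] at h1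
    simp only [pairFunctional_apply, Prod.fst_sub, Prod.snd_sub]
    nlinarith
  · intro h ε hε
    have h := h ε hε
    rw [eventually_nhdsWithin_iff, Metric.eventually_nhds_iff] at h
    obtain ⟨δ, hδ, h⟩ := h
    refine ⟨δ, hδ, fun s k hsk hs => ?_⟩
    have h1 := norm_le_abs_add_norm (s, k)
    have h2 := h (y := (p.1 + s, p.2 + k))
    have h3 : ((p.1 + s, p.2 + k) : ℝ × X) - p = (s, k) := by ext <;> simp
    rw [dist_eq_norm, h3] at h2
    have h4 := h2 (h1.trans_lt hsk) hs
    simp only [pairFunctional_apply] at h4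
    simp only at h1
    nlinarith

lemma psubdiff_iff_neg {u : ℝ → X → ℝ} {p : ℝ × X} {d : ℝ × (X →L[ℝ] ℝ)} :
    d ∈ psubdiff u p.1 p.2 ↔ -d ∈ psuperdiff (fun t x => -u t x) p.1 p.2 := by
  unfold psubdiff psuperdiff
  simp only [Set.mem_ofPred_eq]
  refine forall₂_congr fun ε hε => exists_congr fun δ => and_congr_right fun hδ =>
    forall₄_congr fun s k h1 h2 => ?_
  simp only [Prod.fst_neg, Prod.snd_neg, neg_apply]
  constructor <;> intro h <;> linarith

lemma psubdiff_eventually {u : ℝ → X → ℝ} {p : ℝ × X} {d : ℝ × (X →L[ℝ] ℝ)}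
    (hd : d ∈ psubdiff u p.1 p.2) {ε : ℝ} (hε : 0 < ε) :
    ∀ᶠ q in 𝓝[{q : ℝ × X | 0 ≤ q.1}] p,
      u p.1 p.2 + pairFunctional d (q - p) - ε * ‖q - p‖ ≤ u q.1 q.2 := by
  filter_upwards [psuperdiff_iff.1 (psubdiff_iff_neg.1 hd) ε hε] with q hq
  simp only [pairFunctional_apply, Prod.fst_neg, Prod.snd_neg,
    neg_apply] at hq ⊢
  linarith

lemma functionalPair_mem_psuperdiff {u : ℝ → X → ℝ} {p : ℝ × X} {φ : ℝ × X → ℝ}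
    {φ' : ℝ × X →L[ℝ] ℝ} (hφ : HasFDerivAt φ φ' p)
    (h : ∀ᶠ q in 𝓝[{q : ℝ × X | 0 ≤ q.1}] p, u q.1 q.2 - φ q ≤ u p.1 p.2 - φ p) :
    functionalPair φ' ∈ psuperdiff u p.1 p.2 := by
  rw [psuperdiff_iff]
  intro ε hε
  filter_upwards [h, nhdsWithin_le_nhds (hφ.isLittleO.def hε)] with q hq hq'
  rw [pairFunctional_functionalPair]
  have := (le_abs_self _).trans hq'
  linarith

lemma ContinuousLinearMap.apply_le_of_eventually {E : Type*} [NormedAddCommGroup E]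
    [NormedSpace ℝ E] (ℓ : E →L[ℝ] ℝ) {c : ℝ}
    (h : ∀ ε > (0 : ℝ), ∀ᶠ z in 𝓝 (0 : E), ℓ z ≤ (c + ε) * ‖z‖) (z : E) : ℓ z ≤ c * ‖z‖ := by
  have key : ∀ ε > (0 : ℝ), ℓ z ≤ (c + ε) * ‖z‖ := by
    intro ε hε
    have ht : Tendsto (fun τ : ℝ => τ • z) (𝓝[>] 0) (𝓝 0) := by
      have : Continuous fun τ : ℝ => τ • z := by fun_prop
      exact (by simpa using this.tendsto 0 : Tendsto (fun τ : ℝ => τ • z) (𝓝 0) (𝓝 0)).mono_left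
        nhdsWithin_le_nhds
    obtain ⟨τ, hτ, hτ0⟩ := ((ht.eventually (h ε hε)).and self_mem_nhdsWithin).exists
    have hτ0 : 0 < τ := hτ0
    rw [map_smul, norm_smul, Real.norm_of_nonneg hτ0.le, smul_eq_mul] at hτ
    refine le_of_mul_le_mul_left ?_ hτ0
    linarith
  have ht : Tendsto (fun ε : ℝ => (c + ε) * ‖z‖) (𝓝[>] 0) (𝓝 (c * ‖z‖)) := by
    have : Continuous fun ε : ℝ => (c + ε) * ‖z‖ := by fun_prop
    exact (by simpa using this.tendsto 0 :
      Tendsto (fun ε : ℝ => (c + ε) * ‖z‖) (𝓝 0) (𝓝 (c * ‖z‖))).mono_left nhdsWithin_le_nhds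
  exact ge_of_tendsto ht (eventually_mem_of_tendsto_nhdsWithin tendsto_id |>.mono key)

lemma ContinuousLinearMap.eq_zero_of_eventually {E : Type*} [NormedAddCommGroup E]
    [NormedSpace ℝ E] (ℓ : E →L[ℝ] ℝ)
    (h : ∀ ε > (0 : ℝ), ∀ᶠ z in 𝓝 (0 : E), ℓ z ≤ ε * ‖z‖) : ℓ = 0 := by
  have h0 : ∀ z, ℓ z ≤ 0 := fun z => by
    simpa using ℓ.apply_le_of_eventually (c := 0) (by simpa using h) z
  ext z
  have := h0 (-z)
  rw [map_neg] at this
  simpa using le_antisymm (h0 z) (by linarith)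

lemma eq_functionalPair_of_mem_psuperdiff {u : ℝ → X → ℝ} {p : ℝ × X} (hp : 0 < p.1)
    {φ : ℝ × X → ℝ} {φ' : ℝ × X →L[ℝ] ℝ} (hφ : HasFDerivAt φ φ' p)
    (hle : ∀ᶠ q in 𝓝 p, φ q ≤ u q.1 q.2) (heq : u p.1 p.2 = φ p)
    {d : ℝ × (X →L[ℝ] ℝ)} (hd : d ∈ psuperdiff u p.1 p.2) : d = functionalPair φ' := by
  have hS : {q : ℝ × X | 0 ≤ q.1} ∈ 𝓝 p :=
    (continuous_fst.tendsto p).eventually (le_mem_nhds hp)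
  have h0 : φ' - pairFunctional d = 0 := by
    refine ContinuousLinearMap.eq_zero_of_eventually _ fun ε hε => ?_
    have h1 := psuperdiff_iff.1 hd (ε / 2) (by positivity)
    rw [nhdsWithin_eq_nhds.2 hS] at h1
    have h2 : ∀ᶠ q in 𝓝 p, (φ' - pairFunctional d) (q - p) ≤ ε * ‖q - p‖ := by
      filter_upwards [h1, hle, hφ.isLittleO.def (half_pos hε)] with q h1 h2 h3
      have := (neg_le_abs _).trans h3
      rw [sub_apply]
      linarith
    have h3 : Tendsto (fun z => p + z) (𝓝 0) (𝓝 p) := by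
      simpa using (continuous_const_add p).tendsto 0
    simpa using h3.eventually h2
  rw [sub_eq_zero.1 h0, functionalPair_pairFunctional]

end Differentials

section Perron

lemma exists_hamiltonian_close {Y : Type*} [NormedAddCommGroup Y] {H : ℝ → Y → ℝ → ℝ}
    (hH : ContinuousOn (fun p : ℝ × Y × ℝ => H p.1 p.2.1 p.2.2) {p : ℝ × Y × ℝ | 0 ≤ p.1})
    {p : ℝ × Y} (hp : 0 ≤ p.1) (m₀ : ℝ) {γ : ℝ} (hγ : 0 < γ) :
    ∃ ρ > 0, ∀ (q : ℝ × Y) (a a₀ m : ℝ), 0 ≤ q.1 → ‖q - p‖ < ρ → |a - a₀| < ρ → |m - m₀| < ρ →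
      |(a + H q.1 q.2 m) - (a₀ + H p.1 p.2 m₀)| < γ := by
  obtain ⟨ρ, hρ, h⟩ := Metric.continuousOn_iff.1 hH (p.1, p.2, m₀) hp (γ / 2) (half_pos hγ)
  refine ⟨min ρ (γ / 2), lt_min hρ (half_pos hγ), fun q a a₀ m hq hqp ha hm => ?_⟩
  have h1 : dist (H q.1 q.2 m) (H p.1 p.2 m₀) < γ / 2 := by
    refine h (q.1, q.2, m) hq ?_
    have h2 := (norm_fst_le (q - p)).trans_lt (hqp.trans_le (min_le_left _ _))
    have h3 := (norm_snd_le (q - p)).trans_lt (hqp.trans_le (min_le_left _ _))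
    rw [Prod.fst_sub, ← dist_eq_norm] at h2
    rw [Prod.snd_sub, ← dist_eq_norm] at h3
    exact max_lt h2 (max_lt h3 (hm.trans_le (min_le_left _ _)))
  rw [Real.dist_eq] at h1
  have h2 := ha.trans_le (min_le_right _ _)
  rw [abs_lt] at h1 h2 ⊢
  constructor <;> linarith [h1.1, h1.2, h2.1, h2.2]

/-- The upper semicontinuous envelope of a supremum of viscosity subsolutions satisfies the
subsolution inequality. -/
theorem uscEnvP_subsolution [CompleteSpace X] {B : ℝ × X → ℝ} {M K : ℝ}
    (hB : IsUnitBump B M K) {H : ℝ → X → ℝ → ℝ}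
    (hH : ContinuousOn (fun p : ℝ × X × ℝ => H p.1 p.2.1 p.2.2) {p : ℝ × X × ℝ | 0 ≤ p.1})
    {h : X → ℝ} {u : ℝ → X → ℝ} {g₀ g₁ : ℝ × X → ℝ}
    (hg₀ : Continuous g₀) (hg₁ : Continuous g₁)
    (hu₀ : ∀ q ∈ {q : ℝ × X | 0 ≤ q.1}, g₀ q ≤ u q.1 q.2)
    (hu₁ : ∀ q ∈ {q : ℝ × X | 0 ≤ q.1}, u q.1 q.2 ≤ g₁ q)
    (happrox : ∀ q : ℝ × X, 0 ≤ q.1 → ∀ c < u q.1 q.2, ∃ w : ℝ → X → ℝ, IsEvolSub H h w ∧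
      (∀ q' : ℝ × X, 0 ≤ q'.1 → w q'.1 q'.2 ≤ u q'.1 q'.2) ∧ c < w q.1 q.2)
    {p : ℝ × X} (hp : 0 < p.1) {d : ℝ × (X →L[ℝ] ℝ)}
    (hd : d ∈ psuperdiff (uscEnvP u) p.1 p.2) : d.1 + H p.1 p.2 ‖d.2‖ ≤ 0 := by
  by_contra! hpos
  have hM := hB.one_le
  have hK := hB.lip_nonneg
  obtain ⟨ρ, hρ, hclose⟩ := exists_hamiltonian_close hH hp.le ‖d.2‖ hpos
  set D := pairFunctional d with hD
  set ε : ℝ := ρ / (2 * (2 * K + 1)) with hε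
  have hε0 : 0 < ε := by positivity
  have hερ : (2 * K + 1) * ε < ρ := by
    have : (2 * K + 1) * ε = ρ / 2 := by rw [hε]; field_simp
    linarith
  have hS : {q : ℝ × X | 0 ≤ q.1} ∈ 𝓝 p :=
    (continuous_fst.tendsto p).eventually (le_mem_nhds hp)
  have hev := psuperdiff_iff.1 hd ε hε0
  rw [nhdsWithin_eq_nhds.2 hS, Metric.eventually_nhds_iff] at hev
  obtain ⟨δ, hδ, hev⟩ := hev
  set r : ℝ := min (min (δ / 2) (p.1 / 2)) (ρ / 2) with hr
  have hr0 : 0 < r := by positivity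
  have hrδ : r < δ := by
    have : r ≤ δ / 2 := (min_le_left _ _).trans (min_le_left _ _)
    linarith
  have hrp : r < p.1 := by
    have : r ≤ p.1 / 2 := (min_le_left _ _).trans (min_le_right _ _)
    linarith
  have hrρ : r < ρ := by
    have : r ≤ ρ / 2 := min_le_right _ _
    linarith
  set b : ℝ × X → ℝ := fun q => 2 * ε * r * B (r⁻¹ • (q - p)) with hb
  have hbd := fun q => hB.hasFDerivAt_comp (2 * ε * r) r⁻¹ (by positivity) (by positivity) p q
  set θ : ℝ × X → ℝ := fun q => D (q - p) - b q with hθ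
  have hθd : ∀ q, HasFDerivAt θ (D - fderiv ℝ b q) q := fun q =>
    (D.hasFDerivAt.comp q ((hasFDerivAt_id q).sub_const p)).sub (hbd q).1
  have hθc : Continuous θ := continuous_iff_continuousAt.2 fun q => (hθd q).continuousAt
  have hθp : θ p = -(2 * ε * r) := by simp [hθ, hb, hB.map_zero]
  have hεr : 0 < ε * r := by positivity
  have hpS : p ∈ {q : ℝ × X | 0 ≤ q.1} := hp.le
  have hle : ∀ q ∈ {q : ℝ × X | 0 ≤ q.1}, u q.1 q.2 ≤ uscEnvP u q.1 q.2 := fun q hq =>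
    le_limsup_nhdsWithin (f := fun q : ℝ × X => u q.1 q.2) hg₁.continuousOn hu₁ hq
  have hfreq : ∃ᶠ q in 𝓝[{q : ℝ × X | 0 ≤ q.1}] p,
      uscEnvP u p.1 p.2 - ε * r / 4 < u q.1 q.2 := by
    have := nhdsWithin_neBot_of_mem' hpS
    exact frequently_lt_of_lt_limsup (u := fun q : ℝ × X => u q.1 q.2)
      (isBoundedUnder_ge_nhdsWithin hg₀.continuousOn hu₀ hpS).isCoboundedUnder_le
      (show uscEnvP u p.1 p.2 - ε * r / 4 < uscEnvP u p.1 p.2 by linarith)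
  have hev' : ∀ᶠ q in 𝓝[{q : ℝ × X | 0 ≤ q.1}] p,
      θ q < -(2 * ε * r) + ε * r / 4 ∧ q ∈ Metric.closedBall p r := by
    refine nhdsWithin_le_nhds (Eventually.and ?_ (Metric.closedBall_mem_nhds p hr0))
    exact (hθc.tendsto p).eventually (gt_mem_nhds (by rw [hθp]; linarith))
  obtain ⟨q₀, hq₀, ⟨hθq₀, hq₀r⟩, hq₀S⟩ :=
    (hfreq.and_eventually (hev'.and self_mem_nhdsWithin)).exists
  obtain ⟨w, hw, hwu, hwq₀⟩ := happrox q₀ hq₀S _ hq₀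
  have hball : ∀ q ∈ Metric.closedBall p r, 0 < q.1 := by
    intro q hq
    rw [Metric.mem_closedBall, dist_eq_norm] at hq
    have h1 : |q.1 - p.1| ≤ ‖q - p‖ := norm_fst_le (q - p)
    linarith [neg_le_abs (q.1 - p.1)]
  have hwb : ∀ q ∈ Metric.closedBall p r,
      w q.1 q.2 ≤ uscEnvP u p.1 p.2 + D (q - p) + ε * r := by
    intro q hq
    have hq1 := (hball q hq).le
    have hq2 := hq
    rw [Metric.mem_closedBall] at hq2
    have h1 := hev (hq2.trans_lt hrδ)
    rw [dist_eq_norm] at hq2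
    have h2 : ε * ‖q - p‖ ≤ ε * r := by gcongr
    linarith [hwu q hq1, hle q hq1]
  have husc : UpperSemicontinuousOn (fun q : ℝ × X => w q.1 q.2 + -θ q)
      (Metric.closedBall p r) :=
    (hw.1.mono fun q hq => (hball q hq).le).add hθc.neg.continuousOn.upperSemicontinuousOn
  have hbM : ∀ q, b q ≤ 2 * ε * r * M := fun q =>
    mul_le_mul_of_nonneg_left (hB.le _) (by positivity)
  obtain ⟨g, g', hg, hg', hgn, hgη, z, hz, hzmax⟩ := exists_perturbed_max hB
    Metric.isClosed_closedBall ⟨q₀, hq₀r⟩ husc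
    (A := uscEnvP u p.1 p.2 + ε * r + 2 * ε * r * M)
    (fun q hq => by simp only [hθ]; linarith [hwb q hq, hbM q])
    (η := min ε (ε * r / 4)) (by positivity)
  have hzr : ‖z - p‖ < r := by
    by_contra! hcon
    have hbz : b z = 0 := by
      simp only [hb]
      rw [hB.eq_zero, mul_zero]
      rw [norm_smul, norm_inv, Real.norm_of_nonneg hr0.le, inv_mul_eq_div, le_div_iff₀ hr0]
      linarith
    have h1 := hzmax q₀ hq₀r
    have h2 := hwb z hz
    have h3 := (hgη z).trans (min_le_right _ _)
    have h4 : θ z = D (z - p) := by simp only [hθ, hbz, sub_zero]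
    linarith [hgn q₀]
  have hzpos := hball z hz
  have hφ : HasFDerivAt (fun q => θ q - g q) (D + (-fderiv ℝ b z - g' z)) z := by
    rw [show D + (-fderiv ℝ b z - g' z) = D - fderiv ℝ b z - g' z by abel]
    exact (hθd z).sub (hg z)
  have hmem := functionalPair_mem_psuperdiff (u := w) hφ (by
    refine nhdsWithin_le_nhds ?_
    have : Metric.ball p r ∈ 𝓝 z := Metric.isOpen_ball.mem_nhds (by
      rwa [Metric.mem_ball, dist_eq_norm])
    filter_upwards [this] with q hq
    linarith [hzmax q (Metric.ball_subset_closedBall hq)])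
  have hsub := hw.2.1 z.1 hzpos z.2 _ hmem
  have hnorm : ‖-fderiv ℝ b z - g' z‖ < ρ := by
    have h1 := norm_sub_le (-fderiv ℝ b z) (g' z)
    rw [norm_neg] at h1
    have h2 := (hbd z).2
    have h3 : 2 * ε * r * K * r⁻¹ = 2 * K * ε := by field_simp
    have h4 := (hg' z).trans (min_le_left _ _)
    rw [h3] at h2
    linarith
  have hfin := hclose z _ d.1 _ hzpos.le (hzr.trans hrρ)
    ((abs_functionalPair_fst_sub_le d _).trans_lt hnorm)
    ((abs_norm_functionalPair_snd_sub_le d _).trans_lt hnorm)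
  rw [← hD, abs_lt] at hfin
  linarith [hfin.1]

/-- If the lower semicontinuous envelope of a subsolution violates the supersolution inequality at
a point where it stays strictly below the barrier `G`, then there is a larger subsolution which
still stays below `G`. -/
theorem exists_larger_subsolution {B : ℝ × X → ℝ} {M K : ℝ}
    (hB : IsUnitBump B M K) {H : ℝ → X → ℝ → ℝ}
    (hH : ContinuousOn (fun p : ℝ × X × ℝ => H p.1 p.2.1 p.2.2) {p : ℝ × X × ℝ | 0 ≤ p.1})
    {h : X → ℝ} {U : ℝ → X → ℝ} (hU : IsEvolSub H h U) {g₀ G : ℝ × X → ℝ}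
    (hg₀ : Continuous g₀) (hG : Continuous G)
    (hU₀ : ∀ q ∈ {q : ℝ × X | 0 ≤ q.1}, g₀ q ≤ U q.1 q.2)
    (hUG : ∀ q ∈ {q : ℝ × X | 0 ≤ q.1}, U q.1 q.2 ≤ G q)
    {p : ℝ × X} (hp : 0 < p.1) (hpG : lscEnvP U p.1 p.2 < G p) {d : ℝ × (X →L[ℝ] ℝ)}
    (hd : d ∈ psubdiff (lscEnvP U) p.1 p.2) (hneg : d.1 + H p.1 p.2 ‖d.2‖ < 0) :
    ∃ w : ℝ → X → ℝ, IsEvolSub H h w ∧ (∀ q : ℝ × X, U q.1 q.2 ≤ w q.1 q.2) ∧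
      (∀ q : ℝ × X, 0 ≤ q.1 → w q.1 q.2 ≤ G q) ∧
      ∃ q : ℝ × X, 0 ≤ q.1 ∧ U q.1 q.2 < w q.1 q.2 := by
  have hM := hB.one_le
  have hK := hB.lip_nonneg
  obtain ⟨ρ, hρ, hclose⟩ := exists_hamiltonian_close hH hp.le ‖d.2‖ (neg_pos.2 hneg)
  set D := pairFunctional d with hD
  set V := lscEnvP U with hV
  set ε : ℝ := ρ / (4 * K + 1) with hε
  have hε0 : 0 < ε := by positivity
  have hερ : 4 * K * ε < ρ := by
    have : (4 * K + 1) * ε = ρ := by rw [hε]; field_simp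
    linarith
  have hS : {q : ℝ × X | 0 ≤ q.1} ∈ 𝓝 p :=
    (continuous_fst.tendsto p).eventually (le_mem_nhds hp)
  have hev := psubdiff_eventually hd hε0
  rw [nhdsWithin_eq_nhds.2 hS] at hev
  obtain ⟨c, hc, hcG⟩ := exists_between hpG
  have hevG : ∀ᶠ q in 𝓝 p, c < G q - D (q - p) := by
    have : Continuous fun q => G q - D (q - p) := by fun_prop
    exact (this.tendsto p).eventually (lt_mem_nhds (by simpa using hcG))
  obtain ⟨δ, hδ, hev⟩ := Metric.eventually_nhds_iff.1 (hev.and hevG)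
  set r : ℝ := min (min (δ / 3) (p.1 / 3)) (min ρ ((c - V p.1 p.2) / (4 * ε * M))) with hr
  have hcV : 0 < c - V p.1 p.2 := sub_pos.2 hc
  have hr0 : 0 < r := by positivity
  have hrδ : 2 * r < δ := by
    have : r ≤ δ / 3 := (min_le_left _ _).trans (min_le_left _ _)
    linarith
  have hrp : 2 * r < p.1 := by
    have : r ≤ p.1 / 3 := (min_le_left _ _).trans (min_le_right _ _)
    linarith
  have hrρ : r ≤ ρ := (min_le_right _ _).trans (min_le_left _ _)
  have hrc : 4 * ε * r * M ≤ c - V p.1 p.2 := by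
    have : r ≤ (c - V p.1 p.2) / (4 * ε * M) := (min_le_right _ _).trans (min_le_right _ _)
    rw [le_div_iff₀ (by positivity)] at this
    linarith
  have hεr : 0 < ε * r := by positivity
  set b : ℝ × X → ℝ := fun q => 4 * ε * r * B (r⁻¹ • (q - p)) with hb
  have hbd := fun q => hB.hasFDerivAt_comp (4 * ε * r) r⁻¹ (by positivity) (by positivity) p q
  have hbM : ∀ q, b q ≤ 4 * ε * r * M := fun q =>
    mul_le_mul_of_nonneg_left (hB.le _) (by positivity)
  have hb0 : ∀ q, r ≤ ‖q - p‖ → b q = 0 := by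
    intro q hq
    simp only [hb]
    rw [hB.eq_zero, mul_zero]
    rw [norm_smul, norm_inv, Real.norm_of_nonneg hr0.le, inv_mul_eq_div, le_div_iff₀ hr0]
    linarith
  set φ : ℝ × X → ℝ := fun q => V p.1 p.2 - 3 * ε * r + D (q - p) + b q with hφ
  have hφd : ∀ q, HasFDerivAt φ (D + fderiv ℝ b q) q := fun q =>
    ((D.hasFDerivAt.comp q ((hasFDerivAt_id q).sub_const p)).const_add _).add (hbd q).1
  have hφc : Continuous φ := continuous_iff_continuousAt.2 fun q => (hφd q).continuousAt
  have hφp : φ p = V p.1 p.2 + ε * r := by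
    simp only [hφ, hb, sub_self, smul_zero, hB.map_zero, map_zero]; ring
  have hpos : ∀ q : ℝ × X, ‖q - p‖ < 2 * r → 0 < q.1 := by
    intro q hq
    have h1 : |q.1 - p.1| ≤ ‖q - p‖ := norm_fst_le (q - p)
    linarith [neg_le_abs (q.1 - p.1)]
  have hVU : ∀ q ∈ {q : ℝ × X | 0 ≤ q.1}, V q.1 q.2 ≤ U q.1 q.2 := fun q hq =>
    liminf_nhdsWithin_le (f := fun q : ℝ × X => U q.1 q.2) hg₀.continuousOn hU₀ hq
  have hφU : ∀ q, r ≤ ‖q - p‖ → ‖q - p‖ < 2 * r → φ q < U q.1 q.2 := by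
    intro q h1 h2
    have h3 := (hev (y := q) (by rw [dist_eq_norm]; linarith)).1
    have h4 : ε * ‖q - p‖ < ε * (2 * r) := by gcongr
    have h5 := hVU q (hpos q h2).le
    simp only [hφ, hb0 q h1]
    linarith
  have hφG : ∀ q, ‖q - p‖ < 2 * r → φ q ≤ G q := by
    intro q h2
    have h3 := (hev (y := q) (by rw [dist_eq_norm]; linarith)).2
    simp only [hφ]
    linarith [hbM q]
  let W : ℝ × X → ℝ := fun q => if ‖q - p‖ < 2 * r then max (U q.1 q.2) (φ q) else U q.1 q.2
  have hUW : ∀ q, U q.1 q.2 ≤ W q := by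
    intro q
    by_cases hq : ‖q - p‖ < 2 * r
    · simp only [W, if_pos hq]; exact le_max_left _ _
    · simp only [W, if_neg hq]; exact le_rfl
  have hφW : ∀ q, ‖q - p‖ < 2 * r → φ q ≤ W q := by
    intro q hq
    simp only [W, if_pos hq]; exact le_max_right _ _
  have hWcases : ∀ q, W q = U q.1 q.2 ∨ (‖q - p‖ < r ∧ W q = φ q) := by
    intro q
    by_cases hq : ‖q - p‖ < 2 * r
    · simp only [W, if_pos hq]
      rcases le_or_gt (φ q) (U q.1 q.2) with h1 | h1
      · exact Or.inl (max_eq_left h1)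
      · refine Or.inr ⟨?_, max_eq_right h1.le⟩
        by_contra! h2
        exact lt_asymm h1 (hφU q h2 hq)
    · exact Or.inl (if_neg hq)
  have hnear : ∀ q : ℝ × X, ‖q - p‖ < 2 * r → ∀ᶠ q' in 𝓝 q, ‖q' - p‖ < 2 * r := fun q hq =>
    (by fun_prop : Continuous fun q' : ℝ × X => ‖q' - p‖).tendsto q |>.eventually
      (gt_mem_nhds hq)
  refine ⟨fun t x => W (t, x), ⟨?_, ?_, ?_⟩, hUW, ?_, ?_⟩
  · intro q hq a ha
    have ha : W q < a := ha
    by_cases hqr : ‖q - p‖ < 2 * r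
    · filter_upwards [hU.1 q hq a ((hUW q).trans_lt ha), nhdsWithin_le_nhds
        ((hφc.tendsto q).eventually (gt_mem_nhds ((hφW q hqr).trans_lt ha)))] with q' h1 h2
      show W q' < a
      rcases hWcases q' with h3 | ⟨-, h3⟩ <;> rw [h3] <;> assumption
    · have h0 : ∀ᶠ q' in 𝓝 q, r < ‖q' - p‖ :=
        (by fun_prop : Continuous fun q' : ℝ × X => ‖q' - p‖).tendsto q |>.eventually
          (lt_mem_nhds (by linarith))
      filter_upwards [hU.1 q hq a ((hUW q).trans_lt ha), nhdsWithin_le_nhds h0] with q' h1 h2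
      show W q' < a
      rcases hWcases q' with h3 | ⟨h4, -⟩
      · rwa [h3]
      · exact absurd h4 h2.not_gt
  · intro t ht x d' hd'
    rcases hWcases (t, x) with h1 | ⟨hr1, h1⟩
    · refine hU.2.1 t ht x d' fun ε hε => ?_
      obtain ⟨δ, hδ, h⟩ := hd' ε hε
      refine ⟨δ, hδ, fun s k hsk hs => (hUW (t + s, x + k)).trans ?_⟩
      have := h s k hsk hs
      simp only [h1] at this
      exact this
    · have heq := eq_functionalPair_of_mem_psuperdiff (u := fun t x => W (t, x)) (p := (t, x)) ht
        (hφd (t, x)) ((hnear (t, x) (by linarith)).mono hφW) h1 hd'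
      have hnorm : ‖fderiv ℝ b (t, x)‖ < ρ := by
        have h2 := (hbd (t, x)).2
        have h3 : 4 * ε * r * K * r⁻¹ = 4 * K * ε := by field_simp
        rw [h3] at h2
        exact h2.trans_lt hερ
      have hfin := hclose (t, x) _ d.1 _ ht.le (hr1.trans_le hrρ)
        ((abs_functionalPair_fst_sub_le d _).trans_lt hnorm)
        ((abs_norm_functionalPair_snd_sub_le d _).trans_lt hnorm)
      rw [← hD, ← heq, abs_lt] at hfin
      have := hfin.2
      simp only at this
      linarith
  · intro x
    have h1 : ¬ ‖((0, x) : ℝ × X) - p‖ < 2 * r := fun hcon => (hpos _ hcon).false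
    simp only [W, if_neg h1]
    exact hU.2.2 x
  · intro q hq
    show W q ≤ G q
    rcases hWcases q with h1 | ⟨h2, h1⟩
    · exact h1.trans_le (hUG q hq)
    · exact h1.trans_le (hφG q (by linarith))
  · have hpS : p ∈ {q : ℝ × X | 0 ≤ q.1} := hp.le
    have hfreq : ∃ᶠ q in 𝓝[{q : ℝ × X | 0 ≤ q.1}] p, U q.1 q.2 < V p.1 p.2 + ε * r / 2 := by
      have := nhdsWithin_neBot_of_mem' hpS
      exact frequently_lt_of_liminf_lt (u := fun q : ℝ × X => U q.1 q.2)
        (isBoundedUnder_le_nhdsWithin hG.continuousOn hUG hpS).isCoboundedUnder_ge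
        (show V p.1 p.2 < V p.1 p.2 + ε * r / 2 by linarith)
    have hφev : ∀ᶠ q in 𝓝 p, V p.1 p.2 + ε * r / 2 < φ q :=
      (hφc.tendsto p).eventually (lt_mem_nhds (by rw [hφp]; linarith))
    have hev' : ∀ᶠ q in 𝓝[{q : ℝ × X | 0 ≤ q.1}] p,
        V p.1 p.2 + ε * r / 2 < φ q ∧ ‖q - p‖ < 2 * r :=
      nhdsWithin_le_nhds (hφev.and (hnear p (by simpa using hr0)))
    obtain ⟨q, h1, ⟨h2, h3⟩, h4⟩ :=
      (hfreq.and_eventually (hev'.and self_mem_nhdsWithin)).exists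
    exact ⟨q, h4, (h1.trans h2).trans_le (hφW q h3)⟩

/-- A subdifferential of a function touching `-K₀ t + h(x)` from below has time component `-K₀`
and space component of norm at most the Lipschitz constant of `h`. -/
lemma psubdiff_of_touching {v : ℝ → X → ℝ} {h : X → ℝ} {L K₀ : ℝ} (hL : 0 ≤ L)
    (hh : ∀ y z : X, |h y - h z| ≤ L * ‖y - z‖)
    (hv : ∀ q : ℝ × X, 0 ≤ q.1 → v q.1 q.2 ≤ -K₀ * q.1 + h q.2)
    {p : ℝ × X} (hp : 0 < p.1) (heq : v p.1 p.2 = -K₀ * p.1 + h p.2)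
    {d : ℝ × (X →L[ℝ] ℝ)} (hd : d ∈ psubdiff v p.1 p.2) : d.1 = -K₀ ∧ ‖d.2‖ ≤ L := by
  have hS : {q : ℝ × X | 0 ≤ q.1} ∈ 𝓝 p :=
    (continuous_fst.tendsto p).eventually (le_mem_nhds hp)
  have hev : ∀ ε > (0 : ℝ), ∀ᶠ z : ℝ × X in 𝓝 0,
      d.1 * z.1 + d.2 z.2 ≤ -K₀ * z.1 + (h (p.2 + z.2) - h p.2) + ε * ‖z‖ := by
    intro ε hε
    have h1 := psubdiff_eventually hd hε
    rw [nhdsWithin_eq_nhds.2 hS] at h1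
    have h3 : Tendsto (fun z => p + z) (𝓝 0) (𝓝 p) := by
      simpa using (continuous_const_add p).tendsto 0
    filter_upwards [h3.eventually (h1.and hS)] with z hz
    have h4 := hz.1.trans (hv _ hz.2)
    simp only [pairFunctional_apply, add_sub_cancel_left, Prod.fst_add, Prod.snd_add, heq] at h4
    linarith
  constructor
  · have h0 : (d.1 + K₀) • ContinuousLinearMap.id ℝ ℝ = 0 := by
      refine ContinuousLinearMap.eq_zero_of_eventually _ fun ε hε => ?_
      have ht : Tendsto (fun s : ℝ => ((s, 0) : ℝ × X)) (𝓝 0) (𝓝 0) :=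
        (by fun_prop : Continuous fun s : ℝ => ((s, 0) : ℝ × X)).tendsto 0
      filter_upwards [ht.eventually (hev ε hε)] with s hs
      simp [Prod.norm_def] at hs ⊢
      linarith
    have := congrArg (fun ℓ : ℝ →L[ℝ] ℝ => ℓ 1) h0
    simp at this
    linarith
  · have h0 : ∀ k, d.2 k ≤ L * ‖k‖ := by
      refine ContinuousLinearMap.apply_le_of_eventually _ fun ε hε => ?_
      have ht : Tendsto (fun k : X => ((0, k) : ℝ × X)) (𝓝 0) (𝓝 0) :=
        (by fun_prop : Continuous fun k : X => ((0, k) : ℝ × X)).tendsto 0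
      filter_upwards [ht.eventually (hev ε hε)] with k hk
      have h1 := (le_abs_self _).trans (hh (p.2 + k) p.2)
      rw [add_sub_cancel_left] at h1
      simp [Prod.norm_def] at hk
      linarith
    refine ContinuousLinearMap.opNorm_le_bound _ hL fun k => ?_
    rw [Real.norm_eq_abs, abs_le]
    have := h0 (-k)
    rw [map_neg, norm_neg] at this
    exact ⟨by linarith, h0 k⟩

end Perron

theorem stmt19 [CompleteSpace X] (hbump : HasC1LipBump X)
    (H : ℝ → X → ℝ → ℝ)
    (hHcont : ContinuousOn (fun p : ℝ × X × ℝ => H p.1 p.2.1 p.2.2)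
      {p : ℝ × X × ℝ | 0 ≤ p.1})
    (hHA : CondAEvol H)
    (h : X → ℝ) (L : ℝ) (hL : 0 ≤ L)
    (hhLip : ∀ y z : X, |h y - h z| ≤ L * ‖y - z‖)
    (hhbdd : ∃ C : ℝ, ∀ x, |h x| ≤ C)
    (K₀ K₁ : ℝ)
    (hK : ∀ t : ℝ, 0 < t → ∀ (x : X) (m : ℝ), |m| ≤ L →
      K₀ ≤ H t x m ∧ H t x m ≤ K₁)
    (u : ℝ → X → ℝ)
    (hu : ∀ t : ℝ, 0 ≤ t → ∀ x : X,
      IsLUB {r : ℝ | ∃ w : ℝ → X → ℝ, IsEvolSub H h w ∧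
        (∀ t' : ℝ, 0 < t' → ∀ x' : X,
          -K₁ * t' + h x' ≤ w t' x' ∧ w t' x' ≤ -K₀ * t' + h x') ∧
        r = w t x} (u t x)) :
    IsEvolSub H h (uscEnvP u) ∧ IsEvolSuper H h (lscEnvP (uscEnvP u)) := by
  obtain ⟨B₁, M₁, N₁, hB₁⟩ := exists_isUnitBump_real
  obtain ⟨B₂, M₂, N₂, hB₂⟩ := hbump.exists_isUnitBump
  have hB := hB₁.prod hB₂
  have hhc : Continuous h :=
    (LipschitzWith.of_dist_le_mul (K := ⟨L, hL⟩) fun y z => by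
      rw [Real.dist_eq, dist_eq_norm]; exact hhLip y z).continuous
  have hbarrier : ∀ c : ℝ, Continuous fun q : ℝ × X => -c * q.1 + h q.2 := fun c => by fun_prop
  set S : Set (ℝ × X) := {q | 0 ≤ q.1}
  have hzero : ∀ w : ℝ → X → ℝ, IsEvolSub H h w →
      (∀ t' : ℝ, 0 < t' → ∀ x' : X,
        -K₁ * t' + h x' ≤ w t' x' ∧ w t' x' ≤ -K₀ * t' + h x') → ∀ x, w 0 x = h x := by
    intro w hw hwb x
    refine le_antisymm (hw.2.2 x) (le_of_forall_gt_imp_ge_of_dense fun c hc => ?_)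
    have h1 := hw.1 (0, x) (le_refl (0 : ℝ)) c hc
    have ht : Tendsto (fun t : ℝ => ((t, x) : ℝ × X)) (𝓝[>] 0) (𝓝[S] (0, x)) := by
      refine tendsto_nhdsWithin_iff.2 ⟨?_, ?_⟩
      · exact ((by fun_prop : Continuous fun t : ℝ => ((t, x) : ℝ × X)).tendsto 0).mono_left
          nhdsWithin_le_nhds
      · filter_upwards [self_mem_nhdsWithin] with t ht using (Set.mem_Ioi.1 ht).le
    have hlim : Tendsto (fun t : ℝ => -K₁ * t + h x) (𝓝[>] 0) (𝓝 (h x)) := by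
      have : Continuous fun t : ℝ => -K₁ * t + h x := by fun_prop
      simpa using (this.tendsto 0).mono_left nhdsWithin_le_nhds
    refine le_of_tendsto hlim ?_
    filter_upwards [ht.eventually h1, self_mem_nhdsWithin] with t h2 h3
    exact ((hwb t h3 x).1.trans_lt h2).le
  have hmem : ∀ w : ℝ → X → ℝ, IsEvolSub H h w →
      (∀ t' : ℝ, 0 < t' → ∀ x' : X,
        -K₁ * t' + h x' ≤ w t' x' ∧ w t' x' ≤ -K₀ * t' + h x') →
      ∀ q ∈ S, (-K₁ * q.1 + h q.2 ≤ w q.1 q.2 ∧ w q.1 q.2 ≤ -K₀ * q.1 + h q.2) ∧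
        w q.1 q.2 ≤ u q.1 q.2 := by
    rintro w hw hwb ⟨t, x⟩ (hq : 0 ≤ t)
    refine ⟨?_, (hu t hq x).1 ⟨w, hw, hwb, rfl⟩⟩
    rcases hq.eq_or_lt with rfl | hq
    · simp [hzero w hw hwb x]
    · exact hwb t hq x
  have happrox : ∀ q : ℝ × X, 0 ≤ q.1 → ∀ c < u q.1 q.2, ∃ w : ℝ → X → ℝ, IsEvolSub H h w ∧
      (∀ t' : ℝ, 0 < t' → ∀ x' : X,
        -K₁ * t' + h x' ≤ w t' x' ∧ w t' x' ≤ -K₀ * t' + h x') ∧ c < w q.1 q.2 := by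
    intro q hq c hc
    obtain ⟨_, ⟨w, hw, hwb, rfl⟩, hcw, -⟩ := (hu q.1 hq q.2).exists_between hc
    exact ⟨w, hw, hwb, hcw⟩
  have hu₀ : ∀ q ∈ S, -K₁ * q.1 + h q.2 ≤ u q.1 q.2 := by
    intro q hq
    obtain ⟨w, hw, hwb, -⟩ := happrox q hq _ (sub_one_lt _)
    exact (hmem w hw hwb q hq).1.1.trans (hmem w hw hwb q hq).2
  have hu₁ : ∀ q ∈ S, u q.1 q.2 ≤ -K₀ * q.1 + h q.2 := by
    intro q hq
    refine (hu q.1 hq q.2).2 ?_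
    rintro _ ⟨w, hw, hwb, rfl⟩
    exact (hmem w hw hwb q hq).1.2
  have hcont := fun c => (hbarrier c).continuousOn (s := S)
  set U := uscEnvP u
  have huU : ∀ q ∈ S, u q.1 q.2 ≤ U q.1 q.2 := fun q hq =>
    le_limsup_nhdsWithin (f := fun q : ℝ × X => u q.1 q.2) (hcont K₀) hu₁ hq
  have hU₀ : ∀ q ∈ S, -K₁ * q.1 + h q.2 ≤ U q.1 q.2 := fun q hq =>
    (hu₀ q hq).trans (huU q hq)
  have hU₁ : ∀ q ∈ S, U q.1 q.2 ≤ -K₀ * q.1 + h q.2 := fun q hq =>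
    limsup_nhdsWithin_le (f := fun q : ℝ × X => u q.1 q.2) (hcont K₁) hu₀ (hcont K₀) hu₁ hq
  have hUsub : IsEvolSub H h U := by
    refine ⟨upperSemicontinuousOn_limsup_nhdsWithin (hcont K₁) hu₀ (hcont K₀) hu₁,
      fun t ht x d hd => ?_, fun x => by simpa using hU₁ (0, x) (le_refl (0 : ℝ))⟩
    refine uscEnvP_subsolution (h := h) (p := (t, x)) hB hHcont (hbarrier K₁) (hbarrier K₀) hu₀ hu₁
      (fun q hq c hc => ?_) ht hd
    obtain ⟨w, hw, hwb, hcw⟩ := happrox q hq c hc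
    exact ⟨w, hw, fun q' hq' => (hmem w hw hwb q' hq').2, hcw⟩
  refine ⟨hUsub, lowerSemicontinuousOn_liminf_nhdsWithin (hcont K₁) hU₀ (hcont K₀) hU₁,
    fun t ht x d hd => ?_, fun x => ?_⟩
  · by_contra! hneg
    have hV₁ : ∀ q : ℝ × X, 0 ≤ q.1 → lscEnvP U q.1 q.2 ≤ -K₀ * q.1 + h q.2 := fun q hq =>
      (liminf_nhdsWithin_le (f := fun q : ℝ × X => U q.1 q.2) (hcont K₁) hU₀ hq).trans
        (hU₁ q hq)
    rcases (hV₁ (t, x) ht.le).eq_or_lt with heq | hlt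
    · obtain ⟨h1, h2⟩ := psubdiff_of_touching (p := (t, x)) hL hhLip hV₁ ht heq hd
      have := (hK t ht x ‖d.2‖ (by rwa [abs_norm])).1
      linarith
    · obtain ⟨w, hw, hUw, hwG, q, hq, hlt⟩ := exists_larger_subsolution (p := (t, x)) hB hHcont
        hUsub (hbarrier K₁) (hbarrier K₀) hU₀ hU₁ ht hlt hd hneg
      have hwu := (hmem w hw (fun t' ht' x' =>
        ⟨(hU₀ (t', x') ht'.le).trans (hUw (t', x')), hwG (t', x') ht'.le⟩) q hq).2
      exact absurd (hwu.trans (huU q hq)) hlt.not_ge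
  · have := le_liminf_nhdsWithin (f := fun q : ℝ × X => U q.1 q.2) (hcont K₀) hU₁ (hcont K₁) hU₀
      (p := (0, x)) (le_refl (0 : ℝ))
    simp only [mul_zero, zero_add] at this
    exact this
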